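/- Let A be a Cohen–Macaulay local ring and let M and N be nonzero finitely generated Tor-independent A-modules. If both M and N have reducible complexity, then depth M + depth N = dim A + depth (M ⊗_A N). -/

import Mathlib

open IsLocalRing CategoryTheory

universe u

noncomputable section

/-! Basic commutative-algebra notions: depth, minimal free resolutions, Betti numbers,
complexity, syzygies, reducible complexity, upper reducing degree, Tor-independence,
Gorenstein dimension, CI-dimension, Cohen-Macaulay local rings. -/




/-- The depth of a module over a local ring: the supremum of lengths of regular
sequences on the module consisting of elements of the maximal ideal. -/
def moduleDepth (A : Type u) [CommRing A] [IsLocalRing A]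
    (M : Type u) [AddCommGroup M] [Module A M] : ℕ∞ :=
  sSup {n : ℕ∞ | ∃ rs : List A, (rs.length : ℕ∞) = n ∧
    (∀ x ∈ rs, x ∈ maximalIdeal A) ∧ RingTheory.Sequence.IsRegular M rs}

/-- A minimal free resolution of a module over a local ring. -/
structure MinFreeRes (A : Type u) [CommRing A] [IsLocalRing A]
    (M : Type u) [AddCommGroup M] [Module A M] : Type (u + 1) where
  F : ℕ → ModuleCat.{u} A
  free : ∀ n, Module.Free A (F n)
  fin : ∀ n, Module.Finite A (F n)
  d : ∀ n, F (n + 1) →ₗ[A] F n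
  aug : F 0 →ₗ[A] M
  aug_surj : Function.Surjective aug
  exact_aug : Function.Exact (d 0) aug
  exact_d : ∀ n, Function.Exact (d (n + 1)) (d n)
  minimal : ∀ n x, d n x ∈ (maximalIdeal A) • (⊤ : Submodule A (F n))

/-- The Betti numbers of a minimal free resolution. -/
def MinFreeRes.betti {A : Type u} [CommRing A] [IsLocalRing A]
    {M : Type u} [AddCommGroup M] [Module A M] (R : MinFreeRes A M) (n : ℕ) : ℕ :=
  Module.finrank A (R.F n)

/-- The sequence `β` is eventually bounded by `a * n ^ (t - 1)` for some real `a`. -/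
def CxBound (β : ℕ → ℕ) (t : ℕ) : Prop :=
  ∃ a : ℝ, ∃ N : ℕ, ∀ n, N ≤ n → (β n : ℝ) ≤ a * (n : ℝ) ^ ((t : ℝ) - 1)

/-- The complexity of a module: the least `t` such that the Betti sequence of a minimal
free resolution is eventually bounded by `a * n ^ (t - 1)` for some `a` (and `⊤` if no
such `t` exists). -/
def complexity (A : Type u) [CommRing A] [IsLocalRing A]
    (M : Type u) [AddCommGroup M] [Module A M] : ℕ∞ :=
  sInf {t : ℕ∞ | ∃ t' : ℕ, t = (t' : ℕ∞) ∧ ∃ R : MinFreeRes A M, CxBound R.betti t'}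

/-- A finite resolution of a module `M`:
an exact sequence `0 → G len → ⋯ → G 0 → M → 0`. -/
structure FinRes (A : Type u) [CommRing A]
    (M : Type u) [AddCommGroup M] [Module A M] : Type (u + 1) where
  len : ℕ
  G : ℕ → ModuleCat.{u} A
  d : ∀ n, G (n + 1) →ₗ[A] G n
  aug : G 0 →ₗ[A] M
  bounded : ∀ n, len < n → Subsingleton (G n)
  aug_surj : Function.Surjective aug
  exact_aug : Function.Exact (d 0) aug
  exact_d : ∀ n, Function.Exact (d (n + 1)) (d n)

/-- A module has finite projective dimension if it admits a finite resolution by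
projective modules. -/
def HasFiniteProjDim (A : Type u) [CommRing A]
    (M : Type u) [AddCommGroup M] [Module A M] : Prop :=
  ∃ R : FinRes A M, ∀ n, Module.Projective A (R.G n)

/-- `S` is an `n`-th syzygy of `M`: for `n = 0`, `S ≅ M`; for `n ≥ 1`, `S` is isomorphic to
the image of the `n`-th differential in a minimal free resolution of `M`. -/
def IsSyzygy (A : Type u) [CommRing A] [IsLocalRing A]
    (M : Type u) [AddCommGroup M] [Module A M]
    (S : Type u) [AddCommGroup S] [Module A S] : ℕ → Prop
  | 0 => Nonempty (S ≃ₗ[A] M)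
  | (n + 1) => ∃ R : MinFreeRes A M, Nonempty (S ≃ₗ[A] LinearMap.range (R.d n))

/-- `K` is obtained from `M` by a reduction of complexity coming from a cohomology class
of degree `t ≥ 1`, i.e. there is a short exact sequence `0 → M → K → Ω^{t-1}(M) → 0`. -/
def ReducesWithDeg (A : Type u) [CommRing A] [IsLocalRing A]
    (M K : ModuleCat.{u} A) (t : ℕ) : Prop :=
  1 ≤ t ∧ ∃ (S : Type u) (_ : AddCommGroup S) (_ : Module A S),
    IsSyzygy A M S (t - 1) ∧
    ∃ (f : M →ₗ[A] K) (g : K →ₗ[A] S),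
      Function.Injective f ∧ Function.Surjective g ∧ Function.Exact f g

/-- The class of (bundled) modules having reducible complexity: the smallest class
containing all modules of finite projective dimension, and containing every module `M` of
finite positive complexity admitting a short exact sequence
`0 → M → K → Ω^{t-1}(M) → 0` (coming from a degree-`t` self-extension) with
`cx K < cx M` and `K` of reducible complexity. -/
inductive HasRedCxCat (A : Type u) [CommRing A] [IsLocalRing A] : ModuleCat.{u} A → Prop
  | of_finite_pd (M : ModuleCat.{u} A) : HasFiniteProjDim A M → HasRedCxCat A M
  | of_step (M K : ModuleCat.{u} A) (t : ℕ) :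
      complexity A M ≠ 0 → complexity A M ≠ ⊤ →
      ReducesWithDeg A M K t →
      complexity A K < complexity A M →
      HasRedCxCat A K → HasRedCxCat A M

/-- A module has reducible complexity. -/
def HasReducibleComplexity (A : Type u) [CommRing A] [IsLocalRing A]
    (M : Type u) [AddCommGroup M] [Module A M] : Prop :=
  HasRedCxCat A (ModuleCat.of A M)

/-- A sequence of short exact sequences `0 → K_{i-1} → K_i → Ω^{d_i - 1}(K_{i-1}) → 0`
with strictly decreasing complexities, ending in a module of complexity zero, i.e. a
sequence reducing the complexity of `Ks 0`. -/
def IsReducingSeq (A : Type u) [CommRing A] [IsLocalRing A] (t : ℕ)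
    (Ks : Fin (t + 1) → ModuleCat.{u} A) (degs : Fin t → ℕ) : Prop :=
  (∀ i : Fin t, ReducesWithDeg A (Ks i.castSucc) (Ks i.succ) (degs i)) ∧
  (∀ i : Fin t, complexity A (Ks i.succ) < complexity A (Ks i.castSucc)) ∧
  complexity A (Ks (Fin.last t)) = 0

open Classical in
/-- The upper reducing degree of `M`: `⊤` if `M` has finite projective dimension, and
otherwise the supremum, over all sequences reducing the complexity of `M`, of the minimum
of the degrees of the cohomology classes involved. -/
def upperReducingDegree (A : Type u) [CommRing A] [IsLocalRing A]
    (M : Type u) [AddCommGroup M] [Module A M] : ℕ∞ :=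
  if HasFiniteProjDim A M then ⊤
  else sSup {r : ℕ∞ | ∃ (t : ℕ) (Ks : Fin (t + 1) → ModuleCat.{u} A) (degs : Fin t → ℕ),
    Ks 0 = ModuleCat.of A M ∧ IsReducingSeq A t Ks degs ∧
    r = ⨅ i : Fin t, (degs i : ℕ∞)}

/-- The `n`-th Tor module of two modules. -/
def torModule (A : Type u) [CommRing A] (M N : Type u)
    [AddCommGroup M] [Module A M] [AddCommGroup N] [Module A N] (n : ℕ) : ModuleCat.{u} A :=
  ((Tor (ModuleCat.{u} A) n).obj (ModuleCat.of A M)).obj (ModuleCat.of A N)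

/-- Two modules are Tor-independent if `Tor_n(M, N) = 0` for all `n > 0`. -/
def TorIndep (A : Type u) [CommRing A] (M N : Type u)
    [AddCommGroup M] [Module A M] [AddCommGroup N] [Module A N] : Prop :=
  ∀ n : ℕ, 0 < n → Subsingleton (torModule A M N n)

/-- The `n`-th Ext module of two modules. -/
def extModule (A : Type u) [CommRing A] (M N : Type u)
    [AddCommGroup M] [Module A M] [AddCommGroup N] [Module A N] (n : ℕ) : ModuleCat.{u} A :=
  ((Ext A (ModuleCat.{u} A) n).obj (Opposite.op (ModuleCat.of A M))).obj (ModuleCat.of A N)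

/-- A module `G` has Gorenstein dimension zero if it is reflexive and
`Ext^n(G, A) = 0 = Ext^n(Hom(G, A), A)` for all `n > 0`. -/
def GDimZero (A : Type u) [CommRing A] (G : Type u) [AddCommGroup G] [Module A G] : Prop :=
  Module.IsReflexive A G ∧
  ∀ n : ℕ, 0 < n →
    Subsingleton (extModule A G A n) ∧ Subsingleton (extModule A (Module.Dual A G) A n)

/-- A module has finite Gorenstein dimension if it admits a finite resolution by modules
of Gorenstein dimension zero. -/
def HasFiniteGDim (A : Type u) [CommRing A]
    (M : Type u) [AddCommGroup M] [Module A M] : Prop :=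
  ∃ R : FinRes A M, ∀ n, GDimZero A (R.G n)


/-- The Krull dimension of a ring, viewed in `WithBot ℕ∞`. -/
def ringKrullDimE (A : Type u) [CommRing A] : WithBot ℕ∞ := ringKrullDim A

/-- A local ring is Cohen-Macaulay if its depth equals its Krull dimension. -/
def IsCMLocalRing (A : Type u) [CommRing A] [IsLocalRing A] : Prop :=
  (moduleDepth A A : WithBot ℕ∞) = ringKrullDimE A

/-- A module over a local ring is maximal Cohen-Macaulay if its depth equals the Krull
dimension of the ring. -/
def IsMaxCM (A : Type u) [CommRing A] [IsLocalRing A]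
    (M : Type u) [AddCommGroup M] [Module A M] : Prop :=
  (moduleDepth A M : WithBot ℕ∞) = ringKrullDimE A

/-- A local ring is Gorenstein if and only if every finitely generated module over it has
finite Gorenstein dimension. -/
def IsGorensteinLocalRing (A : Type u) [CommRing A] [IsLocalRing A] : Prop :=
  ∀ M : ModuleCat.{u} A, Module.Finite A M → HasFiniteGDim A M

/-- A module `M` over a local ring `A` has finite CI-dimension if there is a diagram of
local ring homomorphisms `A → R ← Q` with `A → R` flat and `Q → R` surjective with kernel
generated by a regular sequence, such that `R ⊗_A M` has finite projective dimension
over `Q`. -/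
def HasFiniteCIDimMod (A : Type u) [CommRing A] [IsLocalRing A]
    (M : Type u) [AddCommGroup M] [Module A M] : Prop :=
  ∃ (R Q : Type u) (_ : CommRing R) (_ : CommRing Q) (_ : IsLocalRing R) (_ : IsLocalRing Q)
    (f : A →+* R) (g : Q →+* R),
    IsLocalHom f ∧ IsLocalHom g ∧ Function.Surjective g ∧
    (∃ rs : List Q, RingTheory.Sequence.IsRegular Q rs ∧
      RingHom.ker g = Ideal.span {x | x ∈ rs}) ∧
    (letI : Algebra A R := f.toAlgebra
     Module.Flat A R ∧
     (letI : Module Q (TensorProduct A R M) := Module.compHom _ g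
      HasFiniteProjDim Q (TensorProduct A R M)))

section DepthTheory

variable {A : Type u} [CommRing A]

variable {M N M₁ M₂ M₃ : Type u} [AddCommGroup M] [Module A M] [AddCommGroup N] [Module A N]
  [AddCommGroup M₁] [Module A M₁] [AddCommGroup M₂] [Module A M₂] [AddCommGroup M₃] [Module A M₃]

lemma shortExact_of_linearMap {f : M₁ →ₗ[A] M₂} {g : M₂ →ₗ[A] M₃} (hf : Function.Injective f)
    (hg : Function.Surjective g) (hfg : Function.Exact f g) :
    (ShortComplex.mk (ModuleCat.ofHom f) (ModuleCat.ofHom g)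
      (by ext x; exact hfg.apply_apply_eq_zero x)).ShortExact where
  exact := (ShortComplex.ShortExact.moduleCat_exact_iff_function_exact _).mpr hfg
  mono_f := (ModuleCat.mono_iff_injective _).mpr hf
  epi_g := (ModuleCat.epi_iff_surjective _).mpr hg

lemma ext_mk₀_injective_of_linearMap {f : M₁ →ₗ[A] M₂} {g : M₂ →ₗ[A] M₃}
    (hf : Function.Injective f) (hg : Function.Surjective g) (hfg : Function.Exact f g)
    (X : ModuleCat.{u} A)
    (x : Abelian.Ext X (ModuleCat.of A M₁) 0)
    (hx : x.comp (Abelian.Ext.mk₀ (ModuleCat.ofHom f)) (add_zero 0) = 0) : x = 0 := by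
  have := (shortExact_of_linearMap hf hg hfg).mono_f
  refine Abelian.Ext.postcomp_mk₀_injective_of_mono X (ModuleCat.ofHom f) ?_
  simpa using hx

variable [IsLocalRing A]

/-- The modules `Ext^i(k, M)` vanish for all `i < n`, where `k` is the residue field. -/
def ExtVanishesBelow (A : Type u) [CommRing A] [IsLocalRing A]
    (M : Type u) [AddCommGroup M] [Module A M] (n : ℕ) : Prop :=
  ∀ i < n, Subsingleton
    (Abelian.Ext (ModuleCat.of A (ResidueField A)) (ModuleCat.of A M) i)

lemma ExtVanishesBelow.mono {m n : ℕ} (h : ExtVanishesBelow A M n) (hmn : m ≤ n) :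
    ExtVanishesBelow A M m :=
  fun i hi ↦ h i (hi.trans_le hmn)

lemma ExtVanishesBelow.zero : ExtVanishesBelow A M 0 :=
  fun i hi ↦ absurd hi i.not_lt_zero

lemma ExtVanishesBelow.of_subsingleton [Subsingleton M] (n : ℕ) : ExtVanishesBelow A M n :=
  fun _ _ ↦ ⟨fun a b ↦ by
    have h : 𝟙 (ModuleCat.of A M) = 0 := (ModuleCat.isZero_of_subsingleton _).eq_of_src _ _
    rw [← a.comp_mk₀_id, ← b.comp_mk₀_id, h]
    simp⟩

lemma ExtVanishesBelow.middle {f : M₁ →ₗ[A] M₂} {g : M₂ →ₗ[A] M₃}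
    (hf : Function.Injective f) (hg : Function.Surjective g) (hfg : Function.Exact f g) {n : ℕ}
    (h₁ : ExtVanishesBelow A M₁ n)
    (h₃ : ExtVanishesBelow A M₃ n) : ExtVanishesBelow A M₂ n := by
  intro i hi
  have := h₁ i hi
  have := h₃ i hi
  refine subsingleton_of_forall_eq 0 fun x ↦ ?_
  obtain ⟨y, rfl⟩ := Abelian.Ext.covariant_sequence_exact₂ _
    (shortExact_of_linearMap hf hg hfg) x
    (Subsingleton.elim (α := Abelian.Ext _ (ModuleCat.of A M₃) i) _ _)
  rw [Subsingleton.elim (α := Abelian.Ext _ (ModuleCat.of A M₁) i) y 0, Abelian.Ext.zero_comp]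

lemma ExtVanishesBelow.right {f : M₁ →ₗ[A] M₂} {g : M₂ →ₗ[A] M₃}
    (hf : Function.Injective f) (hg : Function.Surjective g) (hfg : Function.Exact f g) {n : ℕ}
    (h₁ : ExtVanishesBelow A M₁ (n + 1))
    (h₂ : ExtVanishesBelow A M₂ n) : ExtVanishesBelow A M₃ n := by
  intro i hi
  have := h₁ (i + 1) (by omega)
  have := h₂ i hi
  refine subsingleton_of_forall_eq 0 fun x ↦ ?_
  obtain ⟨y, rfl⟩ := Abelian.Ext.covariant_sequence_exact₃ _
    (shortExact_of_linearMap hf hg hfg) x rfl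
    (Subsingleton.elim (α := Abelian.Ext _ (ModuleCat.of A M₁) (i + 1)) _ _)
  rw [Subsingleton.elim (α := Abelian.Ext _ (ModuleCat.of A M₂) i) y 0, Abelian.Ext.zero_comp]

lemma ExtVanishesBelow.left_of_comp_eq_zero {f : M₁ →ₗ[A] M₂} {g : M₂ →ₗ[A] M₃}
    (hf : Function.Injective f) (hg : Function.Surjective g) (hfg : Function.Exact f g) {n : ℕ}
    (h : ∀ i ≤ n, ∀ x : Abelian.Ext (ModuleCat.of A (ResidueField A)) (ModuleCat.of A M₁) i,
      x.comp (Abelian.Ext.mk₀ (ModuleCat.ofHom f)) (add_zero i) = 0)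
    (h₃ : ExtVanishesBelow A M₃ n) : ExtVanishesBelow A M₁ (n + 1) := by
  intro i hi
  refine subsingleton_of_forall_eq 0 fun x ↦ ?_
  have hx := h i (by omega) x
  match i with
  | 0 => exact ext_mk₀_injective_of_linearMap hf hg hfg _ x hx
  | i + 1 =>
    have := h₃ i (by omega)
    obtain ⟨y, rfl⟩ := Abelian.Ext.covariant_sequence_exact₁ _
      (shortExact_of_linearMap hf hg hfg) x hx rfl
    rw [Subsingleton.elim (α := Abelian.Ext _ (ModuleCat.of A M₃) i) y 0, Abelian.Ext.zero_comp]

lemma ExtVanishesBelow.left {f : M₁ →ₗ[A] M₂} {g : M₂ →ₗ[A] M₃}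
    (hf : Function.Injective f) (hg : Function.Surjective g) (hfg : Function.Exact f g) {n : ℕ}
    (h₂ : ExtVanishesBelow A M₂ (n + 1))
    (h₃ : ExtVanishesBelow A M₃ n) : ExtVanishesBelow A M₁ (n + 1) :=
  .left_of_comp_eq_zero hf hg hfg (fun i hi _ ↦
    have := h₂ i (by omega)
    Subsingleton.elim (α := Abelian.Ext _ (ModuleCat.of A M₂) i) _ _) h₃

lemma ExtVanishesBelow.of_linearEquiv (e : M ≃ₗ[A] N) {n : ℕ} (h : ExtVanishesBelow A M n) :
    ExtVanishesBelow A N n :=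
  .middle (f := e.toLinearMap) (g := (0 : N →ₗ[A] PUnit.{u + 1})) e.injective
    (fun _ ↦ ⟨0, Subsingleton.elim _ _⟩)
    (fun y ↦ ⟨fun _ ↦ e.surjective y, fun _ ↦ rfl⟩) h (.of_subsingleton n)

lemma ExtVanishesBelow.fin_fun {n : ℕ} (h : ExtVanishesBelow A M n) (m : ℕ) :
    ExtVanishesBelow A (Fin m → M) n := by
  induction m with
  | zero => exact .of_subsingleton n
  | succ m ih =>
    exact .of_linearEquiv (Fin.consLinearEquiv A fun _ ↦ M) <|
      .middle LinearMap.inl_injective LinearMap.snd_surjective .inl_snd h ih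

lemma ExtVanishesBelow.of_retract {n : ℕ} (h : ExtVanishesBelow A M n) (i : N →ₗ[A] M)
    (r : M →ₗ[A] N) (hri : r ∘ₗ i = LinearMap.id) : ExtVanishesBelow A N n := by
  intro j hj
  have := h j hj
  refine subsingleton_of_forall_eq 0 fun x ↦ ?_
  have hid : 𝟙 (ModuleCat.of A N) = ModuleCat.ofHom i ≫ ModuleCat.ofHom r := by
    rw [← ModuleCat.ofHom_comp, hri]; rfl
  have h0 : x.comp (Abelian.Ext.mk₀ (ModuleCat.ofHom i)) (add_zero j) = 0 :=
    Subsingleton.elim (α := Abelian.Ext _ (ModuleCat.of A M) j) _ _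
  rw [← x.comp_mk₀_id, hid, ← Abelian.Ext.mk₀_comp_mk₀,
    ← Abelian.Ext.comp_assoc_of_third_deg_zero, h0, Abelian.Ext.zero_comp]

lemma extVanishesBelow_tensor_free_iff (F : Type u) [AddCommGroup F] [Module A F]
    [Module.Free A F] [Module.Finite A F] [Nontrivial F] (n : ℕ) :
    ExtVanishesBelow A (TensorProduct A F N) n ↔ ExtVanishesBelow A N n := by
  let b := Module.finBasis A F
  let e : TensorProduct A F N ≃ₗ[A] (Fin (Module.finrank A F) → N) :=
    (TensorProduct.congr b.equivFun (LinearEquiv.refl A N)) ≪≫ₗ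
      TensorProduct.comm A _ _ ≪≫ₗ TensorProduct.piScalarRight A A N _
  refine ⟨fun h ↦ ?_, fun h ↦ .of_linearEquiv e.symm (h.fin_fun _)⟩
  obtain ⟨i⟩ := b.index_nonempty
  exact (h.of_linearEquiv e).of_retract (LinearMap.single A (fun _ ↦ N) i) (LinearMap.proj i)
    (by ext; simp)

lemma ExtVanishesBelow.tensor_free (F : Type u) [AddCommGroup F] [Module A F]
    [Module.Free A F] [Module.Finite A F] {n : ℕ} (h : ExtVanishesBelow A N n) :
    ExtVanishesBelow A (TensorProduct A F N) n := by
  cases subsingleton_or_nontrivial F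
  · exact .of_subsingleton n
  · exact (extVanishesBelow_tensor_free_iff F n).mpr h

lemma ExtVanishesBelow.free (F : Type u) [AddCommGroup F] [Module A F]
    [Module.Free A F] [Module.Finite A F] {n : ℕ} (h : ExtVanishesBelow A A n) :
    ExtVanishesBelow A F n :=
  .of_linearEquiv (TensorProduct.rid A F) (h.tensor_free F)

lemma length_le_ringKrullDim_of_isRegular [IsNoetherianRing A] [Module.Finite A M]
    {rs : List A} (hrs : RingTheory.Sequence.IsRegular M rs) :
    (rs.length : WithBot ℕ∞) ≤ ringKrullDim A := by
  have := hrs.nontrivial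
  have hQ := hrs.quot_ofList_smul_nontrivial ⊤
  have h := Module.supportDim_add_length_eq_supportDim_of_isRegular rs hrs
  refine le_trans ?_ (h.le.trans (Module.supportDim_le_ringKrullDim A M))
  obtain ⟨m, hm⟩ := WithBot.ne_bot_iff_exists.mp
    (Module.supportDim_ne_bot_of_nontrivial A (M ⧸ Ideal.ofList rs • (⊤ : Submodule A M)))
  rw [← hm]
  exact le_add_of_nonneg_left (WithBot.coe_le_coe.mpr zero_le)

lemma extVanishesBelow_iff_exists_isRegular [IsNoetherianRing A] [Module.Finite A M]
    [Nontrivial M] (n : ℕ) :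
    ExtVanishesBelow A M n ↔ ∃ rs : List A, rs.length = n ∧ (∀ x ∈ rs, x ∈ maximalIdeal A) ∧
      RingTheory.Sequence.IsRegular M rs := by
  have hlt : maximalIdeal A • (⊤ : Submodule A (ModuleCat.of A M)) < ⊤ :=
    (Submodule.top_ne_ideal_smul_of_le_jacobson_annihilator
      (IsLocalRing.maximalIdeal_le_jacobson _)).symm.lt_top
  have hsupp : Module.support A (ModuleCat.of A (ResidueField A)) =
      PrimeSpectrum.zeroLocus (maximalIdeal A : Set A) := by
    rw [Module.support_eq_zeroLocus]
    exact congrArg _ (congrArg _ (Ideal.annihilator_quotient (I := maximalIdeal A)))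
  have : Module.Finite A (ResidueField A) := inferInstance
  constructor
  · intro h
    exact ModuleCat.exists_isRegular_of_exists_subsingleton_ext _ n (ModuleCat.of A M) hlt
      (ModuleCat.of A (ResidueField A)) hsupp h
  · rintro ⟨rs, rfl, hmem, hrs⟩
    exact ModuleCat.subsingleton_ext_of_exists_isRegular _ (ModuleCat.of A (ResidueField A))
      hsupp.le (ModuleCat.of A M) hlt rs hmem hrs

/-- `n` is the least degree in which `Ext(k, M)` does not vanish. -/
def IsExtDepth (A : Type u) [CommRing A] [IsLocalRing A]
    (M : Type u) [AddCommGroup M] [Module A M] (n : ℕ) : Prop :=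
  ∀ m, ExtVanishesBelow A M m ↔ m ≤ n

lemma exists_isExtDepth [IsNoetherianRing A] [Module.Finite A M] [Nontrivial M] :
    ∃ n : ℕ, IsExtDepth A M n ∧ moduleDepth A M = n ∧ (n : WithBot ℕ∞) ≤ ringKrullDim A := by
  obtain ⟨d, hd⟩ : ∃ d : ℕ, ringKrullDim A = d := by
    have h₁ := ringKrullDim_ne_top (R := A)
    have h₂ := ringKrullDim_ne_bot (R := A)
    generalize ringKrullDim A = x at h₁ h₂
    match x, h₁, h₂ with
    | ((d : ℕ) : ℕ∞), _, _ => exact ⟨d, rfl⟩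
  classical
  have hb (n : ℕ) (h : ExtVanishesBelow A M n) : n ≤ d := by
    obtain ⟨rs, rfl, -, hrs⟩ := (extVanishesBelow_iff_exists_isRegular n).mp h
    exact_mod_cast hd ▸ length_le_ringKrullDim_of_isRegular hrs
  have hn : ExtVanishesBelow A M (Nat.findGreatest (ExtVanishesBelow A M) d) :=
    Nat.findGreatest_spec (Nat.zero_le d) .zero
  refine ⟨_, fun m ↦ ⟨fun h ↦ Nat.le_findGreatest (hb m h) h, hn.mono⟩,
    le_antisymm (sSup_le ?_) (le_sSup ?_), ?_⟩
  · rintro _ ⟨rs, rfl, hmem, hrs⟩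
    have := (extVanishesBelow_iff_exists_isRegular (M := M) rs.length).mpr ⟨rs, rfl, hmem, hrs⟩
    exact_mod_cast Nat.le_findGreatest (hb _ this) this
  · obtain ⟨rs, hlen, hrs⟩ := (extVanishesBelow_iff_exists_isRegular _).mp hn
    exact ⟨rs, by rw [hlen], hrs⟩
  · rw [hd]
    exact_mod_cast hb _ hn

end DepthTheory

section TorIndependence

variable {A : Type u} [CommRing A]

/-- `Tor_1(M, N) = 0`, expressed by exactness of `M ⊗ -` on short exact sequences ending
in `N`. -/
def TorOneVanishes (A : Type u) [CommRing A] (M N : Type u)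
    [AddCommGroup M] [Module A M] [AddCommGroup N] [Module A N] : Prop :=
  ∀ ⦃N₁ N₂ : Type u⦄ [AddCommGroup N₁] [Module A N₁] [AddCommGroup N₂] [Module A N₂]
    (f : N₁ →ₗ[A] N₂) (g : N₂ →ₗ[A] N), Function.Injective f → Function.Surjective g →
    Function.Exact f g → Function.Injective (f.lTensor M)

variable {M N M₁ M₂ M₃ N₁ N₂ : Type u} [AddCommGroup M] [Module A M] [AddCommGroup N] [Module A N]
  [AddCommGroup M₁] [Module A M₁] [AddCommGroup M₂] [Module A M₂] [AddCommGroup M₃] [Module A M₃]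
  [AddCommGroup N₁] [Module A N₁] [AddCommGroup N₂] [Module A N₂]

lemma rTensor_injective_iff_lTensor_injective (f : M₁ →ₗ[A] M₂) :
    Function.Injective (f.rTensor N) ↔ Function.Injective (f.lTensor N) := by
  rw [← LinearMap.comm_comp_rTensor_comp_comm_eq]
  simp

lemma exists_flat_cover (A M : Type u) [CommRing A] [AddCommGroup M] [Module A M] :
    ∃ (Z F : ModuleCat.{u} A) (_ : Module.Flat A F) (i : Z →ₗ[A] F) (p : F →ₗ[A] M),
      Function.Injective i ∧ Function.Surjective p ∧ Function.Exact i p :=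
  let p := Finsupp.linearCombination A (id : M → M)
  ⟨ModuleCat.of A (LinearMap.ker p), ModuleCat.of A (M →₀ A),
    inferInstanceAs (Module.Flat A (M →₀ A)), (LinearMap.ker p).subtype, p,
    Submodule.subtype_injective _, Finsupp.linearCombination_id_surjective A M,
    LinearMap.exact_subtype_ker_map p⟩

lemma TorOneVanishes.of_rTensor_injective [Module.Flat A M₂] {f : M₁ →ₗ[A] M₂} {g : M₂ →ₗ[A] M}
    (hg : Function.Surjective g) (hfg : Function.Exact f g)
    (h : Function.Injective (f.rTensor N)) : TorOneVanishes A M N :=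
  fun _ _ _ _ _ _ _ _ hi hp hip ↦
    lTensor_injective_of_exact_of_exact_of_rTensor_injective hfg hg hip hp h
      (Module.Flat.lTensor_preserves_injective_linearMap _ hi)

lemma TorOneVanishes.of_lTensor_injective [Module.Flat A N₂] {f : N₁ →ₗ[A] N₂} {g : N₂ →ₗ[A] N}
    (hg : Function.Surjective g) (hfg : Function.Exact f g)
    (h : Function.Injective (f.lTensor M)) : TorOneVanishes A M N := by
  obtain ⟨Z, F, hF, i, p, hi, hp, hex⟩ := exists_flat_cover A M
  refine .of_rTensor_injective hp hex ?_
  rw [rTensor_injective_iff_lTensor_injective]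
  refine lTensor_injective_of_exact_of_exact_of_rTensor_injective hfg hg hex hp ?_
    (Module.Flat.lTensor_preserves_injective_linearMap _ hi)
  rwa [rTensor_injective_iff_lTensor_injective]

lemma TorOneVanishes.symm (h : TorOneVanishes A M N) : TorOneVanishes A N M := by
  obtain ⟨Z, F, hF, i, p, hi, hp, hex⟩ := exists_flat_cover A N
  exact .of_rTensor_injective hp hex ((rTensor_injective_iff_lTensor_injective _).mpr
    (h _ _ hi hp hex))

lemma TorOneVanishes.of_flat [Module.Flat A M] : TorOneVanishes A M N :=
  fun _ _ _ _ _ _ _ _ hi _ _ ↦ Module.Flat.lTensor_preserves_injective_linearMap _ hi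

lemma TorOneVanishes.rTensor_injective (h : TorOneVanishes A M₃ N) {f : M₁ →ₗ[A] M₂}
    {g : M₂ →ₗ[A] M₃} (hf : Function.Injective f)
    (hg : Function.Surjective g) (hfg : Function.Exact f g) :
    Function.Injective (f.rTensor N) :=
  (rTensor_injective_iff_lTensor_injective _).mpr (h.symm _ _ hf hg hfg)

lemma TorOneVanishes.middle {f : M₁ →ₗ[A] M₂} {g : M₂ →ₗ[A] M₃} (hf : Function.Injective f)
    (hg : Function.Surjective g) (hfg : Function.Exact f g)
    (h₁ : TorOneVanishes A M₁ N) (h₃ : TorOneVanishes A M₃ N) : TorOneVanishes A M₂ N := by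
  obtain ⟨Z, F, hF, i, p, hi, hp, hex⟩ := exists_flat_cover A N
  refine .of_lTensor_injective hp hex ((injective_iff_map_eq_zero _).mpr fun x hx ↦ ?_)
  have hx' : g.rTensor _ x = 0 := by
    refine h₃ i p hi hp hex ?_
    rw [← LinearMap.comp_apply, LinearMap.lTensor_comp_rTensor, ← LinearMap.rTensor_comp_lTensor,
      LinearMap.comp_apply, hx, map_zero, map_zero]
  obtain ⟨y, rfl⟩ := (rTensor_exact _ hfg hg x).mp hx'
  have hy : i.lTensor M₁ y = 0 := by
    refine Module.Flat.rTensor_preserves_injective_linearMap f hf ?_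
    rw [← LinearMap.comp_apply, LinearMap.rTensor_comp_lTensor, ← LinearMap.lTensor_comp_rTensor,
      LinearMap.comp_apply, hx, map_zero]
  rw [h₁ i p hi hp hex (hy.trans (map_zero _).symm), map_zero]

/-- The `n`-th syzygy of a module in a chosen projective resolution. -/
def resolutionSyzygy (N : ModuleCat.{u} A) : ℕ → ModuleCat.{u} A
  | 0 => N
  | n + 1 => ModuleCat.of A
      (LinearMap.range ((projectiveResolution N).complex.d (n + 1) n).hom)

/-- The inclusion of a syzygy in the preceding term of the resolution. -/
def resolutionSyzygyInclusion (N : ModuleCat.{u} A) (n : ℕ) :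
    resolutionSyzygy N (n + 1) →ₗ[A] (projectiveResolution N).complex.X n :=
  (LinearMap.range ((projectiveResolution N).complex.d (n + 1) n).hom).subtype

lemma resolutionSyzygyInclusion_injective (N : ModuleCat.{u} A) (n : ℕ) :
    Function.Injective (resolutionSyzygyInclusion N n) :=
  Submodule.subtype_injective _

lemma resolutionSyzygy_cover (N : ModuleCat.{u} A) (n : ℕ) :
    ∃ g : (projectiveResolution N).complex.X n →ₗ[A] resolutionSyzygy N n,
      Function.Surjective g ∧ Function.Exact (resolutionSyzygyInclusion N n) g := by
  suffices ∃ g : (projectiveResolution N).complex.X n →ₗ[A] resolutionSyzygy N n,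
      Function.Surjective g ∧
      Function.Exact ((projectiveResolution N).complex.d (n + 1) n).hom g by
    obtain ⟨g, hg, hex⟩ := this
    exact ⟨g, hg, LinearMap.exact_iff.mpr
      ((LinearMap.exact_iff.mp hex).trans (Submodule.range_subtype _).symm)⟩
  cases n with
  | zero =>
    refine ⟨((projectiveResolution N).π.f 0).hom, ?_, ?_⟩
    · exact (ModuleCat.epi_iff_surjective _).mp inferInstance
    · exact (ShortComplex.ShortExact.moduleCat_exact_iff_function_exact _).mp
        (projectiveResolution N).exact₀
  | succ n =>
    refine ⟨LinearMap.rangeRestrict _, LinearMap.surjective_rangeRestrict _, ?_⟩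
    have := (ShortComplex.ShortExact.moduleCat_exact_iff_function_exact _).mp
      ((projectiveResolution N).exact_succ n)
    exact fun x ↦ (Subtype.ext_iff.trans Iff.rfl).trans (this x)

instance (N : ModuleCat.{u} A) (n : ℕ) :
    Module.Projective A ((projectiveResolution N).complex.X n) :=
  (IsProjective.iff_projective _).mpr ((projectiveResolution N).projective n)

/-- `Tor_n(M, N) = 0` for all `n > 0`, expressed through the syzygies of `N`. -/
def TorVanishes (A : Type u) [CommRing A] (M N : Type u)
    [AddCommGroup M] [Module A M] [AddCommGroup N] [Module A N] : Prop :=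
  ∀ n, TorOneVanishes A M (resolutionSyzygy (ModuleCat.of A N) n)

lemma TorVanishes.torOneVanishes (h : TorVanishes A M N) : TorOneVanishes A M N := h 0

lemma TorIndep.torVanishes (h : TorIndep A M N) : TorVanishes A M N := by
  intro n
  set P := projectiveResolution (ModuleCat.of A N)
  obtain ⟨g, hg, hex⟩ := resolutionSyzygy_cover (ModuleCat.of A N) n
  have hexact : Function.Exact ((P.complex.d (n + 2) (n + 1)).hom.lTensor M)
      ((P.complex.d (n + 1) n).hom.lTensor M) := by
    have hz : Limits.IsZero (torModule A M N (n + 1)) :=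
      have := h (n + 1) n.succ_pos
      ModuleCat.isZero_of_subsingleton _
    have hz' := hz.of_iso (P.isoLeftDerivedObj
      ((MonoidalCategory.tensoringLeft (ModuleCat.{u} A)).obj (ModuleCat.of A M)) (n + 1)).symm
    rw [HomologicalComplex.homologyFunctor_obj, ← HomologicalComplex.exactAt_iff_isZero_homology,
      HomologicalComplex.exactAt_iff' _ (n + 2) (n + 1) n (by simp) (by simp)] at hz'
    exact (ShortComplex.ShortExact.moduleCat_exact_iff_function_exact _).mp hz'
  set d := (P.complex.d (n + 1) n).hom
  refine .of_lTensor_injective (f := (LinearMap.range d).subtype) hg hex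
    ((injective_iff_map_eq_zero _).mpr fun x hx ↦ ?_)
  obtain ⟨y, rfl⟩ := LinearMap.lTensor_surjective M d.surjective_rangeRestrict x
  rw [← LinearMap.comp_apply, ← LinearMap.lTensor_comp] at hx
  obtain ⟨z, rfl⟩ := (hexact y).mp hx
  rw [← LinearMap.comp_apply, ← LinearMap.lTensor_comp]
  have : d.rangeRestrict ∘ₗ (P.complex.d (n + 2) (n + 1)).hom = 0 := by
    ext x
    exact congr($(P.complex.d_comp_d (n + 2) (n + 1) n).hom x)
  rw [this, LinearMap.lTensor_zero, LinearMap.zero_apply]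

lemma TorVanishes.middle {f : M₁ →ₗ[A] M₂} {g : M₂ →ₗ[A] M₃}
    (hf : Function.Injective f) (hg : Function.Surjective g) (hfg : Function.Exact f g)
    (h₁ : TorVanishes A M₁ N) (h₃ : TorVanishes A M₃ N) :
    TorVanishes A M₂ N :=
  fun n ↦ .middle hf hg hfg (h₁ n) (h₃ n)

lemma TorVanishes.left {f : M₁ →ₗ[A] M₂} {g : M₂ →ₗ[A] M₃}
    (hf : Function.Injective f) (hg : Function.Surjective g) (hfg : Function.Exact f g)
    (h₂ : TorVanishes A M₂ N) (h₃ : TorVanishes A M₃ N) :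
    TorVanishes A M₁ N := by
  intro n
  obtain ⟨p, hp, hex⟩ := resolutionSyzygy_cover (ModuleCat.of A N) n
  have hi := resolutionSyzygyInclusion_injective (ModuleCat.of A N) n
  refine .of_lTensor_injective hp hex ?_
  have h := (h₂ n _ _ hi hp hex).comp
    ((h₃ (n + 1)).rTensor_injective hf hg hfg)
  rw [← LinearMap.coe_comp, LinearMap.lTensor_comp_rTensor,
    ← LinearMap.rTensor_comp_lTensor, LinearMap.coe_comp] at h
  exact h.of_comp

lemma TorVanishes.of_flat [Module.Flat A M] : TorVanishes A M N :=
  fun _ ↦ .of_flat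

lemma TorVanishes.symm (h : TorVanishes A M N) : TorVanishes A N M := by
  suffices ∀ n, TorVanishes A (resolutionSyzygy (ModuleCat.of A M) n) N from
    fun n ↦ (this n).torOneVanishes.symm
  intro n
  induction n with
  | zero => exact h
  | succ n ih =>
    obtain ⟨p, hp, hex⟩ := resolutionSyzygy_cover (ModuleCat.of A M) n
    exact .left (resolutionSyzygyInclusion_injective _ n) hp hex .of_flat ih

lemma TorVanishes.of_linearEquiv (e : M₁ ≃ₗ[A] M₂) (h : TorVanishes A M₁ N) :
    TorVanishes A M₂ N :=
  .middle (f := e.toLinearMap) (g := (0 : M₂ →ₗ[A] PUnit.{u + 1})) e.injective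
    (fun _ ↦ ⟨0, Subsingleton.elim _ _⟩)
    (fun y ↦ ⟨fun _ ↦ e.surjective y, fun _ ↦ rfl⟩) h .of_flat

end TorIndependence

section FiniteProjectiveDimension

variable {A : Type u} [CommRing A]

lemma HasFiniteProjDim.exists_hasProjectiveDimensionLT {M : Type u} [AddCommGroup M] [Module A M]
    (h : HasFiniteProjDim A M) : ∃ n, HasProjectiveDimensionLT (ModuleCat.of A M) n := by
  obtain ⟨R, hR⟩ := h
  have hG (n : ℕ) : Projective (R.G n) := (IsProjective.iff_projective _).mp (hR n)
  have key (k : ℕ) : ∀ n, R.len ≤ n + k →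
      HasProjectiveDimensionLT (ModuleCat.of A (LinearMap.range (R.d n))) k := by
    induction k with
    | zero =>
      intro n hn
      have := R.bounded (n + 1) (by omega)
      have : Subsingleton (LinearMap.range (R.d n)) :=
        (R.d n).surjective_rangeRestrict.subsingleton
      exact (ModuleCat.isZero_of_subsingleton _).hasProjectiveDimensionLT_zero
    | succ k ih =>
      intro n hn
      have hex : Function.Exact (LinearMap.range (R.d (n + 1))).subtype (R.d n).rangeRestrict := by
        rw [LinearMap.exact_iff, LinearMap.ker_rangeRestrict, Submodule.range_subtype]
        exact LinearMap.exact_iff.mp (R.exact_d n)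
      have : HasProjectiveDimensionLT (R.G (n + 1)) (k + 1) :=
        hasProjectiveDimensionLT_of_ge _ 1 _ (by omega)
      exact (shortExact_of_linearMap (Submodule.subtype_injective _)
        (R.d n).surjective_rangeRestrict hex).hasProjectiveDimensionLT_X₃ k
          (ih (n + 1) (by omega)) this
  have hex : Function.Exact (LinearMap.range (R.d 0)).subtype R.aug := by
    rw [LinearMap.exact_iff, Submodule.range_subtype]
    exact LinearMap.exact_iff.mp R.exact_aug
  have : HasProjectiveDimensionLT (R.G 0) (R.len + 1) :=
    hasProjectiveDimensionLT_of_ge _ 1 _ (by omega)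
  exact ⟨R.len + 1, (shortExact_of_linearMap (Submodule.subtype_injective _)
    R.aug_surj hex).hasProjectiveDimensionLT_X₃ R.len (key R.len 0 (by omega)) this⟩

variable [IsLocalRing A]

lemma exists_minimal_cover [IsNoetherianRing A] (M : Type u) [AddCommGroup M] [Module A M]
    [Module.Finite A M] :
    ∃ (Z F : ModuleCat.{u} A) (_ : Module.Finite A Z) (_ : Module.Finite A F)
      (_ : Module.Free A F) (i : Z →ₗ[A] F) (p : F →ₗ[A] M),
      Function.Injective i ∧ Function.Surjective p ∧ Function.Exact i p ∧
      ∀ z, i z ∈ maximalIdeal A • (⊤ : Submodule A F) := by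
  let k := ResidueField A
  let b := Module.finBasis k (TensorProduct A k M)
  obtain ⟨v, hv⟩ := (TensorProduct.mk_surjective A M k Ideal.Quotient.mk_surjective).comp_left b
  have hv (i) : (1 : k) ⊗ₜ[A] v i = b i := congr_fun hv i
  let p := Fintype.linearCombination A v
  refine ⟨ModuleCat.of A (LinearMap.ker p), ModuleCat.of A (Fin _ → A),
    inferInstanceAs (Module.Finite A (LinearMap.ker p)),
    inferInstanceAs (Module.Finite A (Fin _ → A)), inferInstanceAs (Module.Free A (Fin _ → A)),
    (LinearMap.ker p).subtype, p, Submodule.subtype_injective _, ?_,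
    LinearMap.exact_subtype_ker_map p, ?_⟩
  · rw [← LinearMap.range_eq_top, Fintype.range_linearCombination]
    exact IsLocalRing.span_eq_top_of_tmul_eq_basis v b hv
  · rintro ⟨x, hx⟩
    have hx0 : ∑ i, residue A (x i) • b i = 0 := by
      have := congr((1 : k) ⊗ₜ[A] $(LinearMap.mem_ker.mp hx))
      rw [Fintype.linearCombination_apply, TensorProduct.tmul_sum, TensorProduct.tmul_zero] at this
      rw [← this]
      refine Finset.sum_congr rfl fun i _ ↦ ?_
      rw [TensorProduct.tmul_smul, hv, ← ResidueField.algebraMap_eq, algebraMap_smul]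
    have hxi (i) : x i ∈ maximalIdeal A := by
      rw [← residue_eq_zero_iff]
      exact Fintype.linearIndependent_iff.mp b.linearIndependent _ hx0 i
    change x ∈ _
    rw [pi_eq_sum_univ' x]
    exact Submodule.sum_mem _ fun i _ ↦ Submodule.smul_mem_smul (hxi i) trivial

variable {M N Z F : Type u} [AddCommGroup M] [Module A M] [AddCommGroup N] [Module A N]
  [AddCommGroup Z] [Module A Z] [AddCommGroup F] [Module A F]

lemma linearMap_mem_smul_top [Module.Free A Z] [Module.Finite A Z] (I : Ideal A) (f : Z →ₗ[A] F)
    (hf : ∀ z, f z ∈ I • (⊤ : Submodule A F)) : f ∈ I • (⊤ : Submodule A (Z →ₗ[A] F)) := by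
  let b := Module.finBasis A Z
  have hsum : f = ∑ i, LinearMap.smulRightₗ (b.coord i) (f (b i)) := by
    refine b.ext fun j ↦ ?_
    simp [Finsupp.single_apply]
  rw [hsum]
  refine Submodule.sum_mem _ fun i _ ↦ ?_
  have := Submodule.mem_map_of_mem
    (f := LinearMap.smulRightₗ (M₂ := Z) (M := F) (b.coord i)) (hf (b i))
  rw [Submodule.map_smul''] at this
  exact Submodule.smul_mono le_rfl le_top this

lemma ext_residueField_comp_eq_zero (f : M →ₗ[A] N)
    (hf : f ∈ maximalIdeal A • (⊤ : Submodule A (M →ₗ[A] N))) {n : ℕ}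
    (x : Abelian.Ext (ModuleCat.of A (ResidueField A)) (ModuleCat.of A M) n) :
    x.comp (Abelian.Ext.mk₀ (ModuleCat.ofHom f)) (add_zero n) = 0 := by
  refine Submodule.smul_induction_on hf (fun a ha g _ ↦ ?_) fun g h hg hh ↦ ?_
  · have ha' : a • 𝟙 (ModuleCat.of A (ResidueField A)) = 0 := by
      ext y
      obtain ⟨y, rfl⟩ := residue_surjective y
      change a • residue A y = 0
      rw [Algebra.smul_def, ResidueField.algebraMap_eq, (residue_eq_zero_iff a).mpr ha, zero_mul]
    have hax : a • x = 0 := by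
      have : a • x = (Abelian.Ext.mk₀ (a • 𝟙 (ModuleCat.of A (ResidueField A)))).comp x
          (zero_add n) := by simp [Abelian.Ext.mk₀_smul]
      rw [this, ha']
      simp
    rw [show ModuleCat.ofHom (a • g) = a • ModuleCat.ofHom g from rfl, Abelian.Ext.mk₀_smul,
      Abelian.Ext.comp_smul, ← Abelian.Ext.smul_comp, hax, Abelian.Ext.zero_comp]
  · rw [ModuleCat.ofHom_add, Abelian.Ext.mk₀_add, Abelian.Ext.comp_add, hg, hh, add_zero]

/-- Tensoring with a module of finite projective dimension shifts the vanishing range of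
`Ext(k, -)` by a constant. -/
theorem exists_extVanishesBelow_tensor_iff [IsNoetherianRing A] [Module.Finite A M] [Nontrivial M]
    (n : ℕ) (hM : HasProjectiveDimensionLT (ModuleCat.of A M) n) :
    ∃ p : ℕ, (p = 0 → Module.Free A M) ∧
      ∀ (N : Type u) [AddCommGroup N] [Module A N], TorVanishes A M N →
        ∀ j, ExtVanishesBelow A (TensorProduct A M N) j ↔ ExtVanishesBelow A N (j + p) := by
  induction n generalizing M with
  | zero =>
    have := isZero_of_hasProjectiveDimensionLT_zero (ModuleCat.of A M)
    have := (ModuleCat.isZero_iff_subsingleton.mp this)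
    exact absurd this (not_subsingleton M)
  | succ n ih =>
    by_cases hfree : Module.Free A M
    · exact ⟨0, fun _ ↦ hfree, fun N _ _ _ j ↦ extVanishesBelow_tensor_free_iff M j⟩
    obtain ⟨Z, F, _, _, _, i, g, hi, hg, hex, hmin⟩ := exists_minimal_cover (A := A) M
    have := hg.nontrivial
    have : Nontrivial Z := by
      by_contra h
      rw [not_nontrivial_iff_subsingleton] at h
      refine hfree (.of_equiv (LinearEquiv.ofBijective g ⟨?_, hg⟩))
      rw [← LinearMap.ker_eq_bot, LinearMap.exact_iff.mp hex, LinearMap.range_eq_bot]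
      exact Subsingleton.elim _ _
    have : Projective (ModuleCat.of A F) :=
      (IsProjective.iff_projective F).mp (Module.Projective.of_free (R := A) (P := F))
    have hZ : HasProjectiveDimensionLT (ModuleCat.of A Z) n := by
      cases n with
      | zero =>
        have : Projective (ModuleCat.of A M) := projective_iff_hasProjectiveDimensionLT_one.mpr hM
        have : Module.Projective A M := (IsProjective.iff_projective _).mpr this
        exact absurd Module.free_of_flat_of_isLocalRing hfree
      | succ n =>
        exact ((shortExact_of_linearMap hi hg hex).hasProjectiveDimensionLT_X₃_iff n this).mp hM
    obtain ⟨q, hq0, hq⟩ := ih hZ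
    refine ⟨q + 1, fun h ↦ absurd h (by omega), fun N _ _ hMN j ↦ ?_⟩
    have hX := hq N (.left hi hg hex .of_flat hMN)
    have hY := extVanishesBelow_tensor_free_iff (A := A) (N := N) F
    have hi' := hMN.torOneVanishes.rTensor_injective hi hg hex
    have hg' := LinearMap.rTensor_surjective N hg
    have hex' := rTensor_exact N hex hg
    rw [show j + (q + 1) = j + 1 + q by omega, ← hX]
    refine ⟨fun h ↦ ?_, fun h ↦ .right hi' hg' hex' h ((hY j).mpr (((hX _).mp h).mono (by omega)))⟩
    by_cases hq' : q = 0
    · have := hq0 hq'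
      refine .left_of_comp_eq_zero hi' hg' hex' (fun l _ x ↦ ext_residueField_comp_eq_zero _ ?_ x) h
      have := Submodule.mem_map_of_mem (f := LinearMap.rTensorHom (M := N))
        (linearMap_mem_smul_top _ i hmin)
      rw [Submodule.map_smul''] at this
      exact Submodule.smul_mono le_rfl le_top this
    · suffices ∀ l ≤ j + 1, ExtVanishesBelow A (TensorProduct A Z N) l from this _ le_rfl
      intro l
      induction l with
      | zero => exact fun _ ↦ .zero
      | succ l ihl =>
        intro hl
        have := (hX l).mp (ihl (by omega))
        exact .left hi' hg' hex' ((hY _).mpr (this.mono (by omega))) (h.mono (by omega))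

end FiniteProjectiveDimension

section DepthFormula

variable {A : Type u} [CommRing A] [IsLocalRing A]

variable {M N M₁ M₂ M₃ S : Type u} [AddCommGroup M] [Module A M] [AddCommGroup N] [Module A N]
  [AddCommGroup M₁] [Module A M₁] [AddCommGroup M₂] [Module A M₂] [AddCommGroup M₃] [Module A M₃]
  [AddCommGroup S] [Module A S]

lemma nontrivial_tensorProduct_of_isLocalRing [Module.Finite A M] [Module.Finite A N]
    [Nontrivial M] [Nontrivial N] : Nontrivial (TensorProduct A M N) := by
  let k := ResidueField A
  have hk (X : Type u) [AddCommGroup X] [Module A X] [Module.Finite A X] [Nontrivial X] :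
      Nontrivial (TensorProduct A k X) := by
    rw [← not_subsingleton_iff_nontrivial, IsLocalRing.subsingleton_tensorProduct]
    exact not_subsingleton X
  have := hk M
  have := hk N
  have h : Nontrivial (TensorProduct k (TensorProduct A k M) (TensorProduct A k N)) := inferInstance
  rw [(TensorProduct.AlgebraTensorModule.cancelBaseChange A k k _ N).nontrivial_congr,
    (TensorProduct.assoc A k M N).nontrivial_congr] at h
  by_contra h'
  rw [not_nontrivial_iff_subsingleton] at h'
  exact not_subsingleton (TensorProduct A k (TensorProduct A M N)) inferInstance

/-- The depth formula `depth M + depth N = depth A + depth (M ⊗ N)`. -/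
def DepthFormula (A : Type u) [CommRing A] [IsLocalRing A] (M N : Type u)
    [AddCommGroup M] [Module A M] [AddCommGroup N] [Module A N] : Prop :=
  ∀ a b c d : ℕ, IsExtDepth A M a → IsExtDepth A N b → IsExtDepth A (TensorProduct A M N) c →
    IsExtDepth A A d → a + b = d + c

lemma IsExtDepth.of_linearEquiv (e : M ≃ₗ[A] N) {n : ℕ} (h : IsExtDepth A M n) :
    IsExtDepth A N n :=
  fun m ↦ ⟨fun hN ↦ (h m).mp (hN.of_linearEquiv e.symm), fun hm ↦ ((h m).mpr hm).of_linearEquiv e⟩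

lemma IsExtDepth.unique {m n : ℕ} (hm : IsExtDepth A M m) (hn : IsExtDepth A M n) : m = n :=
  le_antisymm ((hn m).mp ((hm m).mpr le_rfl)) ((hm n).mp ((hn n).mpr le_rfl))

lemma DepthFormula.symm (h : DepthFormula A M N) : DepthFormula A N M :=
  fun a b c d ha hb hc hd ↦ by
    rw [add_comm, h b a c d hb ha (hc.of_linearEquiv (TensorProduct.comm A N M)) hd]

lemma depthFormula_of_hasFiniteProjDim [IsNoetherianRing A] [Module.Finite A M] [Nontrivial M]
    (hM : HasFiniteProjDim A M) (hMN : TorVanishes A M N) : DepthFormula A M N := by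
  intro a b c d ha hb hc hd
  obtain ⟨n, hn⟩ := hM.exists_hasProjectiveDimensionLT
  obtain ⟨p, -, hp⟩ := exists_extVanishesBelow_tensor_iff n hn
  have hN (j : ℕ) : j ≤ c ↔ j + p ≤ b := by rw [← hc j, hp N hMN j, hb]
  have hA (j : ℕ) : j ≤ a ↔ j + p ≤ d := by
    rw [← hd, ← hp A (TorVanishes.of_flat (M := A)).symm j,
      ← (ha.of_linearEquiv (TensorProduct.rid A M).symm) j]
  have := (hN c).mp le_rfl
  have := (hN (b - p)).mpr (by omega)
  have := (hA a).mp le_rfl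
  have := (hA (d - p)).mpr (by omega)
  omega

lemma IsExtDepth.middle {f : M₁ →ₗ[A] M₂} {g : M₂ →ₗ[A] M₃} (hf : Function.Injective f)
    (hg : Function.Surjective g) (hfg : Function.Exact f g) {n : ℕ}
    (h₁ : IsExtDepth A M₁ n) (h₃ : ExtVanishesBelow A M₃ n) : IsExtDepth A M₂ n := by
  refine fun m ↦ ⟨fun h ↦ ?_, fun h ↦ (((h₁ n).mpr le_rfl).middle hf hg hfg h₃).mono h⟩
  by_contra hm
  have := (h₁ (n + 1)).mp (.left hf hg hfg (h.mono (by omega)) h₃)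
  omega

lemma ExtVanishesBelow.kernel {f : M₁ →ₗ[A] M₂} {g : M₂ →ₗ[A] M₃} (hf : Function.Injective f)
    (hg : Function.Surjective g) (hfg : Function.Exact f g) {n : ℕ}
    (h₂ : ExtVanishesBelow A M₂ n) (h₃ : ExtVanishesBelow A M₃ n) : ExtVanishesBelow A M₁ n := by
  cases n with
  | zero => exact .zero
  | succ n => exact .left hf hg hfg h₂ (h₃.mono n.le_succ)

/-- Conditions on a module relative to `N` that are inherited by syzygies. -/
structure SyzygyHereditary (A : Type u) [CommRing A] [IsLocalRing A] (N : Type u)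
    [AddCommGroup N] [Module A N] (m n : ℕ) (S : Type u) [AddCommGroup S] [Module A S] : Prop where
  finite : Module.Finite A S
  torVanishes : TorVanishes A S N
  extVanishesBelow : ExtVanishesBelow A S m
  extVanishesBelow_tensor : ExtVanishesBelow A (TensorProduct A S N) n

lemma SyzygyHereditary.of_linearEquiv {m n : ℕ} (e : M ≃ₗ[A] S)
    (h : SyzygyHereditary A N m n M) : SyzygyHereditary A N m n S where
  finite := have := h.finite; .equiv e
  torVanishes := h.torVanishes.of_linearEquiv e
  extVanishesBelow := h.extVanishesBelow.of_linearEquiv e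
  extVanishesBelow_tensor := h.extVanishesBelow_tensor.of_linearEquiv (e.rTensor N)

lemma SyzygyHereditary.kernel [IsNoetherianRing A] [Module.Free A M₂] [Module.Finite A M₂]
    {f : M₁ →ₗ[A] M₂} {g : M₂ →ₗ[A] M₃} (hf : Function.Injective f)
    (hg : Function.Surjective g) (hfg : Function.Exact f g) {m n : ℕ}
    (hA : ExtVanishesBelow A A m) (hN : ExtVanishesBelow A N n)
    (h : SyzygyHereditary A N m n M₃) : SyzygyHereditary A N m n M₁ where
  finite := .of_injective f hf
  torVanishes := .left hf hg hfg .of_flat h.torVanishes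
  extVanishesBelow := .kernel hf hg hfg (hA.free M₂) h.extVanishesBelow
  extVanishesBelow_tensor := .kernel (h.torVanishes.torOneVanishes.rTensor_injective hf hg hfg)
    (LinearMap.rTensor_surjective N hg) (rTensor_exact N hfg hg) (hN.tensor_free M₂)
    h.extVanishesBelow_tensor

lemma IsSyzygy.syzygyHereditary [IsNoetherianRing A] {m n t : ℕ} (hS : IsSyzygy A M S t)
    (hA : ExtVanishesBelow A A m) (hN : ExtVanishesBelow A N n)
    (h : SyzygyHereditary A N m n M) : SyzygyHereditary A N m n S := by
  cases t with
  | zero =>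
    obtain ⟨e⟩ := hS
    exact h.of_linearEquiv e.symm
  | succ t =>
    obtain ⟨R, ⟨e⟩⟩ := hS
    refine .of_linearEquiv e.symm ?_
    clear e
    have := R.free
    have := R.fin
    induction t with
    | zero =>
      refine .kernel (Submodule.subtype_injective _) R.aug_surj ?_ hA hN h
      rw [LinearMap.exact_iff, Submodule.range_subtype]
      exact LinearMap.exact_iff.mp R.exact_aug
    | succ t ih =>
      refine .kernel (Submodule.subtype_injective _) (R.d t).surjective_rangeRestrict ?_ hA hN ih
      rw [LinearMap.exact_iff, LinearMap.ker_rangeRestrict, Submodule.range_subtype]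
      exact LinearMap.exact_iff.mp (R.exact_d t)

lemma IsCMLocalRing.isExtDepth_le [IsNoetherianRing A] (hCM : IsCMLocalRing A)
    [Module.Finite A M] [Nontrivial M] {a d : ℕ} (ha : IsExtDepth A M a) (hd : IsExtDepth A A d) :
    a ≤ d := by
  obtain ⟨n, hn, -, hle⟩ := exists_isExtDepth (A := A) (M := M)
  obtain ⟨m, hm, hdepth, -⟩ := exists_isExtDepth (A := A) (M := A)
  rw [ha.unique hn, hd.unique hm]
  rw [IsCMLocalRing, hdepth, ringKrullDimE] at hCM
  exact_mod_cast hle.trans hCM.ge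

/-- The depth formula passes from `K` to `X` along `0 → X → K → Ω^{t-1} X → 0` when
`depth (X ⊗ N) ≤ depth N` or `depth X < depth A`; hence it holds for every `X` of reducible
complexity if it holds for all modules satisfying neither inequality. -/
theorem HasRedCxCat.depthFormula [IsNoetherianRing A] (hCM : IsCMLocalRing A)
    [Module.Finite A N] [Nontrivial N]
    (hN : ∀ (Y : Type u) [AddCommGroup Y] [Module A Y] [Module.Finite A Y] [Nontrivial Y],
      TorVanishes A Y N → ∀ a b c d : ℕ, IsExtDepth A Y a → IsExtDepth A N b →
        IsExtDepth A (TensorProduct A Y N) c → IsExtDepth A A d →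
        c ≤ b ∨ a < d ∨ DepthFormula A Y N)
    {X : ModuleCat.{u} A} (hX : HasRedCxCat A X) (hfin : Module.Finite A X) (hnon : Nontrivial X)
    (hXN : TorVanishes A X N) : DepthFormula A X N := by
  induction hX with
  | of_finite_pd X hX => exact depthFormula_of_hasFiniteProjDim hX hXN
  | of_step X K t _ _ hred _ _ ih =>
    obtain ⟨-, S, _, _, hS, f, g, hf, hg, hfg⟩ := hred
    intro a b c d ha hb hc hd
    have had := hCM.isExtDepth_le ha hd
    have hAa := (hd a).mpr had
    have hSyz (e : ℕ) (hec : e ≤ c) (heb : e ≤ b) : SyzygyHereditary A N a e S :=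
      hS.syzygyHereditary hAa ((hb e).mpr heb)
        ⟨hfin, hXN, (ha a).mpr le_rfl, (hc e).mpr hec⟩
    have hS0 := hSyz 0 c.zero_le b.zero_le
    have := hS0.finite
    have : Module.Finite A K := .of_exact hfg hg
    have : Nontrivial K := hf.nontrivial
    have hK := ih inferInstance inferInstance (.middle hf hg hfg hXN hS0.torVanishes)
    have haK := ha.middle hf hg hfg hS0.extVanishesBelow
    have hf' := hS0.torVanishes.torOneVanishes.rTensor_injective hf hg hfg
    have hg' := LinearMap.rTensor_surjective N hg
    have hfg' := rTensor_exact N hfg hg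
    by_cases hcb : c ≤ b
    · exact hK a b c d haK hb
        (hc.middle hf' hg' hfg' (hSyz c le_rfl hcb).extVanishesBelow_tensor) hd
    obtain h | had' | h := hN X hXN a b c d ha hb hc hd
    · exact absurd h hcb
    · have := nontrivial_tensorProduct_of_isLocalRing (A := A) (M := K) (N := N)
      obtain ⟨c', hc', -⟩ := exists_isExtDepth (A := A) (M := TensorProduct A K N)
      have := hK a b c' d haK hb hc' hd
      have := (hc' b).mp (.middle hf' hg' hfg' ((hc b).mpr (by omega))
        (hSyz b (by omega) le_rfl).extVanishesBelow_tensor)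
      omega
    · exact h a b c d ha hb hc hd

lemma HasReducibleComplexity.depthFormula_of_isExtDepth [IsNoetherianRing A]
    (hCM : IsCMLocalRing A) [Module.Finite A M] [Nontrivial M] [Module.Finite A N] [Nontrivial N]
    (hM : HasReducibleComplexity A M) (hMN : TorVanishes A M N) {n : ℕ} (hN : IsExtDepth A N n)
    (hA : IsExtDepth A A n) : DepthFormula A M N := by
  refine HasRedCxCat.depthFormula hCM (fun Y _ _ _ _ _ a b c d _ hb hc hd ↦ .inl ?_) hM ‹_› ‹_› hMN
  have := nontrivial_tensorProduct_of_isLocalRing (A := A) (M := Y) (N := N)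
  rw [hb.unique hN]
  exact hCM.isExtDepth_le hc hA

lemma HasReducibleComplexity.depthFormula [IsNoetherianRing A]
    (hCM : IsCMLocalRing A) [Module.Finite A M] [Nontrivial M] [Module.Finite A N] [Nontrivial N]
    (hM : HasReducibleComplexity A M) (hN : HasReducibleComplexity A N)
    (hMN : TorVanishes A M N) : DepthFormula A M N := by
  refine HasRedCxCat.depthFormula hCM (fun Y _ _ _ _ hYN a b c d ha _ _ hd ↦ .inr ?_) hM ‹_› ‹_› hMN
  obtain h | rfl := (hCM.isExtDepth_le ha hd).lt_or_eq
  · exact .inl h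
  · exact .inr (hN.depthFormula_of_isExtDepth hCM hYN.symm ha hd).symm

end DepthFormula

/-- **Depth formula - Cohen-Macaulay case 2 (Theorem 3.6).** Let `A` be a Cohen-Macaulay
local ring and `M`, `N` nonzero finitely generated Tor-independent `A`-modules. If both
`M` and `N` have reducible complexity, then
`depth M + depth N = dim A + depth (M ⊗ N)`. -/
theorem depth_formula_cohen_macaulay_case_two (A : Type u) [CommRing A] [IsNoetherianRing A]
    [IsLocalRing A] (hCM : IsCMLocalRing A)
    (M N : Type u) [AddCommGroup M] [Module A M] [AddCommGroup N] [Module A N]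
    [Module.Finite A M] [Module.Finite A N]
    (hM : Nontrivial M) (hN : Nontrivial N)
    (hTor : TorIndep A M N)
    (hredM : HasReducibleComplexity A M)
    (hredN : HasReducibleComplexity A N) :
    (moduleDepth A M : WithBot ℕ∞) + (moduleDepth A N : WithBot ℕ∞) =
      ringKrullDimE A + (moduleDepth A (TensorProduct A M N) : WithBot ℕ∞) := by
  obtain ⟨a, ha, hMa, -⟩ := exists_isExtDepth (A := A) (M := M)
  obtain ⟨b, hb, hNb, -⟩ := exists_isExtDepth (A := A) (M := N)
  have := nontrivial_tensorProduct_of_isLocalRing (A := A) (M := M) (N := N)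
  obtain ⟨c, hc, hMNc, -⟩ := exists_isExtDepth (A := A) (M := TensorProduct A M N)
  obtain ⟨d, hd, hAd, -⟩ := exists_isExtDepth (A := A) (M := A)
  rw [← show _ = ringKrullDimE A from hCM, hMa, hNb, hMNc, hAd]
  exact_mod_cast hredM.depthFormula hCM hredN hTor.torVanishes a b c d ha hb hc hd
end
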